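/- For n ≥ 3, let c, c' : Z/nZ → ℤ be two cyclic charge sequences in each of which every three cyclically consecutive values are pairwise distinct. If c and c' induce the same codeword, i.e., for every i ∈ Z/nZ, the number of indices j ∈ {i, i+1} with c_j < c_{i+2} equals the number of indices j ∈ {i, i+1} with c'_j < c'_{i+2}, then c and c' induce the same sequence of window permutations: for every i, the permutation in S_3 given by the relative order of (c_i, c_{i+1}, c_{i+2}) equals the permutation given by the relative order of (c'_i, c'_{i+1}, c'_{i+2}). (This is the injectivity of the mapping from realizable base-words to legal codewords in the (1,3,n)-LRM scheme.) -/

import Mathlib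

/-- A cyclic charge sequence `c : ZMod n → ℤ` has pairwise distinct values in every
window of three cyclically consecutive cells. -/
def DistinctWindows3 (n : ℕ) (c : ZMod n → ℤ) : Prop :=
  ∀ i : ZMod n, ∀ k l : Fin 3, k ≠ l →
    c (i + ((k : ℕ) : ZMod n)) ≠ c (i + ((l : ℕ) : ZMod n))

/-- The `i`-th symbol of the codeword induced by a charge sequence `c` in the
`(1,3,n)`-LRM scheme: the number of indices `j ∈ {i, i+1}` with `c j < c (i+2)`. -/
def codewordSymbol3 (n : ℕ) (c : ZMod n → ℤ) (i : ZMod n) : ℕ :=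
  (Finset.univ.filter (fun j : Fin 2 => c (i + ((j : ℕ) : ZMod n)) < c (i + 2))).card

theorem symbol_eq_aux (n : ℕ) (c : ZMod n → ℤ) (i : ZMod n) :
    codewordSymbol3 n c i =
      (if c i < c (i + 2) then 1 else 0) + (if c (i + 1) < c (i + 2) then 1 else 0) := by
  unfold codewordSymbol3
  rw [Finset.card_filter, Fin.sum_univ_two]
  simp

theorem distinct_aux (n : ℕ) (c : ZMod n → ℤ) (hc : DistinctWindows3 n c) (i : ZMod n) :
    c i ≠ c (i + 1) ∧ c i ≠ c (i + 2) ∧ c (i + 1) ≠ c (i + 2) := by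
  have h1 := hc i 0 1 (by decide)
  have h2 := hc i 0 2 (by decide)
  have h3 := hc i 1 2 (by decide)
  simp at h1 h2 h3
  exact ⟨h1, h2, h3⟩

/-- If two charge sequences (with pairwise distinct values in every window of three
cyclically consecutive cells) induce the same codeword, then they induce the same
sequence of window permutations, i.e. the relative orders of the charges within each
window agree. -/
theorem same_codeword_same_permutations (n : ℕ) (hn : 3 ≤ n)
    (c c' : ZMod n → ℤ)
    (hc : DistinctWindows3 n c) (hc' : DistinctWindows3 n c')
    (hg : ∀ i : ZMod n, codewordSymbol3 n c i = codewordSymbol3 n c' i) :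
    ∀ i : ZMod n, ∀ k l : Fin 3,
      (c (i + ((k : ℕ) : ZMod n)) < c (i + ((l : ℕ) : ZMod n)) ↔
        c' (i + ((k : ℕ) : ZMod n)) < c' (i + ((l : ℕ) : ZMod n))) := by
  haveI : NeZero n := ⟨by omega⟩
  have e : ∀ i : ZMod n, i + 1 + 1 = i + 2 := fun i => by ring
  have hD := distinct_aux n c hc
  have hD' := distinct_aux n c' hc'
  simp only [symbol_eq_aux] at hg
  have hex : ∃ i : ZMod n, ¬ (c i < c (i + 2) ↔ ¬ c (i + 1) < c (i + 2)) := by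
    by_contra! hall
    obtain ⟨m, hm⟩ := Finite.exists_min (fun i : ZMod n => |c (i + 1) - c i|)
    have h1 := hm (m + 1)
    have h2 := hall m
    have h3 := hD m
    simp only [e] at h1
    rcases abs_cases (c (m + 1) - c m) with h | h <;>
      rcases abs_cases (c (m + 2) - c (m + 1)) with h' | h' <;> omega
  obtain ⟨i0, hi0⟩ := hex
  have hb : ∀ m : ℕ, (c (i0 + 1 + m) < c (i0 + 1 + m + 1) ↔
      c' (i0 + 1 + m) < c' (i0 + 1 + m + 1)) := by
    intro m
    induction m with
    | zero =>
      have h1 := hg i0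
      have h2 := hD i0
      have h3 := hD' i0
      simp only [Nat.cast_zero, add_zero, e]
      split_ifs at h1 <;> omega
    | succ k ih =>
      have h1 := hg (i0 + 1 + k)
      have h2 := hD (i0 + 1 + k)
      have h3 := hD' (i0 + 1 + k)
      push_cast
      simp only [← add_assoc, e (i0 + 1 + (k : ZMod n))]
      split_ifs at h1 <;> omega
  have hP : ∀ i : ZMod n, (c i < c (i + 1) ↔ c' i < c' (i + 1)) := by
    intro i
    have h := hb (i - i0 - 1).val
    rw [ZMod.natCast_zmod_val] at h
    have e2 : i0 + 1 + (i - i0 - 1) = i := by ring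
    rwa [e2] at h
  intro i k l
  have h0 := hP i
  have h1 := hg i
  have h2 := hD i
  have h3 := hD' i
  fin_cases k <;> fin_cases l <;> simp <;> split_ifs at h1 <;> omega
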